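/- arXiv:1705.05006 — 2 statements merged into one kernel-verified Lean document; each statement's English description precedes it below -/
import Mathlib

section
/- There exists a sequence ε_n ≥ 0 with ε_n → 0 as n → ∞ such that for every integer n ≥ 2 and every probability mass function p on ℕ, the risk of the Good-Turing estimator satisfies |n·R_n(M^GT, p) − E[2·Φ_2(X^n)/n + (Φ_1(X^n)/n)·(1 − Φ_1(X^n)/n)]| ≤ ε_n. -/
open scoped BigOperators

noncomputable section

/-- `p` is a probability mass function on `ℕ`. -/
def IsPMF (p : ℕ → ℝ) : Prop := (∀ u, 0 ≤ p u) ∧ HasSum p 1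

/-- `N_u(X^n)`: the number of appearances of the symbol `u` in the sample `x`. -/
def nOcc {n : ℕ} (x : Fin n → ℕ) (u : ℕ) : ℕ :=
  (Finset.univ.filter fun i => x i = u).card

/-- Probability of the sample `x` under the `n`-fold product measure `p^⊗n`. -/
def sampleProb {n : ℕ} (p : ℕ → ℝ) (x : Fin n → ℕ) : ℝ := ∏ i, p (x i)

/-- Expectation of `f(X^n)` for `X^n ∼ p^⊗n`. -/
def expct (n : ℕ) (p : ℕ → ℝ) (f : (Fin n → ℕ) → ℝ) : ℝ :=
  ∑' x : Fin n → ℕ, sampleProb p x * f x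

/-- The missing mass `M₀(X^n) = ∑_u p(u) 𝟙[N_u(X^n) = 0]`. -/
def missingMass {n : ℕ} (p : ℕ → ℝ) (x : Fin n → ℕ) : ℝ :=
  ∑' u : ℕ, if nOcc x u = 0 then p u else 0

/-- `Φ_i(X^n)`: the number of symbols appearing exactly `i` times in `x` (for `i ≥ 1`). -/
def phi {n : ℕ} (i : ℕ) (x : Fin n → ℕ) : ℕ :=
  ((Finset.univ.image x).filter fun u => nOcc x u = i).card

/-- The Good-Turing estimator `M^GT(X^n) = Φ₁(X^n)/n`. -/
def goodTuring {n : ℕ} (x : Fin n → ℕ) : ℝ := (phi 1 x : ℝ) / n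

/-- The squared-error risk `R_n(M̂, p) = E[(M̂(X^n) - M₀(X^n))²]`. -/
def risk (n : ℕ) (p : ℕ → ℝ) (M : (Fin n → ℕ) → ℝ) : ℝ :=
  expct n p fun x => (M x - missingMass p x) ^ 2

/-- The worst-case risk of the Good-Turing estimator, `sup_p R_n(M^GT, p)`. -/
def gtWorstRisk (n : ℕ) : ℝ :=
  sSup {r : ℝ | ∃ p : ℕ → ℝ, IsPMF p ∧ r = risk n p goodTuring}

open MeasureTheory

/-- The indicator that the symbol `u` appears exactly `k` times in the sample `x`. -/
def occInd {n : ℕ} (k u : ℕ) (x : Fin n → ℕ) : ℝ := if nOcc x u = k then 1 else 0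

lemma occInd_nonneg {n : ℕ} (k u : ℕ) (x : Fin n → ℕ) : 0 ≤ occInd k u x := by
  unfold occInd; split_ifs <;> norm_num

lemma occInd_le_one {n : ℕ} (k u : ℕ) (x : Fin n → ℕ) : occInd k u x ≤ 1 := by
  unfold occInd; split_ifs <;> norm_num

lemma occInd_mul_self {n : ℕ} (k u : ℕ) (x : Fin n → ℕ) :
    occInd k u x * occInd k u x = occInd k u x := by
  unfold occInd; split_ifs <;> norm_num

lemma occInd_mul_of_ne {n : ℕ} {k l : ℕ} (h : k ≠ l) (u : ℕ) (x : Fin n → ℕ) :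
    occInd k u x * occInd l u x = 0 := by
  unfold occInd; split_ifs <;> simp_all

lemma occInd_eq_sum {n : ℕ} (k u : ℕ) (x : Fin n → ℕ) :
    occInd k u x = ∑ s ∈ Finset.powersetCard k (Finset.univ : Finset (Fin n)),
      ∏ j, (if (x j = u ↔ j ∈ s) then (1 : ℝ) else 0) := by
  have h : ∀ s : Finset (Fin n), (∏ j, (if (x j = u ↔ j ∈ s) then (1 : ℝ) else 0)) =
      if (Finset.univ.filter fun i => x i = u) = s then 1 else 0 := by
    intro s
    rw [Finset.prod_ite_zero]
    simp [Finset.ext_iff]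
  simp only [h, Finset.sum_ite_eq, Finset.mem_powersetCard_univ]
  rfl

lemma hasSum_phi {n : ℕ} {k : ℕ} (hk : k ≠ 0) (x : Fin n → ℕ) :
    HasSum (fun u => occInd k u x) (phi k x : ℝ) := by
  have h : (phi k x : ℝ) = ∑ u ∈ Finset.univ.image x, occInd k u x := by
    simp [phi, occInd, Finset.sum_boole]
  rw [h]
  apply hasSum_sum_of_ne_finset_zero
  intro u hu
  have : nOcc x u = 0 := by
    simpa [nOcc, Finset.filter_eq_empty_iff] using hu
  simp [occInd, this, hk.symm]

lemma phi_le {n : ℕ} (k : ℕ) (x : Fin n → ℕ) : phi k x ≤ n := by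
  refine (Finset.card_filter_le _ _).trans (Finset.card_image_le.trans ?_)
  simp

lemma measurable_of_sample {n : ℕ} (f : (Fin n → ℕ) → ℝ) : Measurable f :=
  Measurable.of_discrete

section Moments

variable (μ : Measure ℕ)

lemma integral_eq_symbol (u : ℕ) : ∫ y, (if y = u then (1 : ℝ) else 0) ∂μ = μ.real {u} := by
  have : (fun y => if y = u then (1 : ℝ) else 0) = Set.indicator {u} 1 := by
    ext y; simp [Set.indicator_apply]
  rw [this, integral_indicator_one (measurableSet_singleton u)]

/-- Exchange of expectation and summation over symbols, against a bounded weight. -/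
lemma hasSum_integral_mul {n : ℕ} {F : ℕ → (Fin n → ℕ) → ℝ} {S W : (Fin n → ℕ) → ℝ} {b : ℕ → ℝ}
    {C : ℝ} (hS : ∀ x, HasSum (fun u => F u x) (S x)) (hW : ∀ x, |W x| ≤ C)
    (hF : ∀ u, Integrable (F u) (Measure.pi fun _ : Fin n => μ)) (hb : Summable b)
    (hFb : ∀ u, ∫ x, |F u x| ∂(Measure.pi fun _ : Fin n => μ) ≤ b u) :
    HasSum (fun u => ∫ x, W x * F u x ∂(Measure.pi fun _ : Fin n => μ))
      (∫ x, W x * S x ∂(Measure.pi fun _ : Fin n => μ)) := by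
  have hWF : ∀ u, Integrable (fun x => W x * F u x) (Measure.pi fun _ : Fin n => μ) := fun u =>
    (hF u).bdd_mul (measurable_of_sample W).aestronglyMeasurable (ae_of_all _ hW)
  have h := hasSum_integral_of_summable_integral_norm (F := fun u x => W x * F u x) hWF ?_
  · simpa only [((hS _).mul_left _).tsum_eq] using h
  · refine Summable.of_nonneg_of_le (fun u => integral_nonneg fun x => norm_nonneg _) (fun u => ?_)
      (hb.mul_left C)
    calc ∫ x, ‖W x * F u x‖ ∂(Measure.pi fun _ : Fin n => μ)
        ≤ ∫ x, C * |F u x| ∂(Measure.pi fun _ : Fin n => μ) := by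
          refine integral_mono (hWF u).norm ((hF u).abs.const_mul C) fun x => ?_
          simp only [Real.norm_eq_abs, abs_mul]
          exact mul_le_mul_of_nonneg_right (hW x) (abs_nonneg _)
      _ ≤ C * b u := by
          rw [integral_const_mul]
          by_cases hn : Nonempty (Fin n → ℕ)
          · obtain ⟨x⟩ := hn
            exact mul_le_mul_of_nonneg_left (hFb u) ((abs_nonneg _).trans (hW x))
          · exact absurd ⟨fun _ => 0⟩ hn

variable [IsProbabilityMeasure μ]

lemma integrable_sample_of_bound {n : ℕ} {f : (Fin n → ℕ) → ℝ} (C : ℝ) (h : ∀ x, |f x| ≤ C) :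
    Integrable f (Measure.pi fun _ : Fin n => μ) :=
  Integrable.of_bound (measurable_of_sample f).aestronglyMeasurable C (ae_of_all _ h)

lemma integrable_occInd {n : ℕ} (k u : ℕ) :
    Integrable (occInd k u) (Measure.pi fun _ : Fin n => μ) :=
  integrable_sample_of_bound μ 1 fun x => by
    rw [abs_of_nonneg (occInd_nonneg _ _ _)]; exact occInd_le_one _ _ _

lemma integrable_occInd_mul {n : ℕ} (k u l v : ℕ) :
    Integrable (fun x => occInd k u x * occInd l v x) (Measure.pi fun _ : Fin n => μ) :=
  integrable_sample_of_bound μ 1 fun x => by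
    rw [abs_of_nonneg (mul_nonneg (occInd_nonneg _ _ _) (occInd_nonneg _ _ _))]
    exact mul_le_one₀ (occInd_le_one _ _ _) (occInd_nonneg _ _ _) (occInd_le_one _ _ _)

lemma integrable_symbol {f : ℕ → ℝ} (C : ℝ) (h : ∀ x, |f x| ≤ C) : Integrable f μ :=
  Integrable.of_bound Measurable.of_discrete.aestronglyMeasurable C (ae_of_all _ h)

lemma integrable_eq_symbol (u : ℕ) : Integrable (fun y => if y = u then (1 : ℝ) else 0) μ :=
  integrable_symbol μ 1 fun x => by split_ifs <;> simp

lemma integral_iff_symbol (u : ℕ) (a : Prop) [Decidable a] :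
    ∫ y, (if (y = u ↔ a) then (1 : ℝ) else 0) ∂μ = if a then μ.real {u} else 1 - μ.real {u} := by
  by_cases ha : a
  · simp only [ha, iff_true, if_true, integral_eq_symbol]
  · have : (fun y => if (y = u ↔ a) then (1 : ℝ) else 0) =
        fun y => 1 - (if y = u then (1 : ℝ) else 0) := by
      ext y; by_cases hy : y = u <;> simp [ha, hy]
    rw [this, integral_sub (integrable_const _) (integrable_eq_symbol μ u), integral_eq_symbol]
    simp [ha]

lemma integral_iff_mul_iff_symbol {u v : ℕ} (huv : u ≠ v) (a b : Prop) [Decidable a] [Decidable b] :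
    ∫ y, (if (y = u ↔ a) then (1 : ℝ) else 0) * (if (y = v ↔ b) then (1 : ℝ) else 0) ∂μ =
      if a then (if b then 0 else μ.real {u})
      else (if b then μ.real {v} else 1 - μ.real {u} - μ.real {v}) := by
  have key : (fun y => (if (y = u ↔ a) then (1 : ℝ) else 0) * (if (y = v ↔ b) then (1 : ℝ) else 0)) =
      fun y => if a then (if b then 0 else if y = u then 1 else 0)
        else (if b then (if y = v then 1 else 0)
          else 1 - (if y = u then 1 else 0) - (if y = v then 1 else 0)) := by
    ext y
    by_cases ha : a <;> by_cases hb : b <;> by_cases hu : y = u <;> by_cases hv : y = v <;>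
      simp_all
  rw [key]
  by_cases ha : a <;> by_cases hb : b <;> simp only [ha, hb, if_true, if_false]
  · simp
  · exact integral_eq_symbol μ u
  · exact integral_eq_symbol μ v
  · have hi : Integrable (fun y => 1 - (if y = u then (1 : ℝ) else 0)) μ :=
      (integrable_const _).sub (integrable_eq_symbol μ u)
    rw [integral_sub hi (integrable_eq_symbol μ v),
      integral_sub (integrable_const _) (integrable_eq_symbol μ u), integral_eq_symbol,
      integral_eq_symbol]
    simp

lemma integral_occInd {n : ℕ} (k u : ℕ) :
    ∫ x, occInd k u x ∂(Measure.pi fun _ : Fin n => μ) =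
      n.choose k * (μ.real {u} ^ k * (1 - μ.real {u}) ^ (n - k)) := by
  simp only [occInd_eq_sum]
  rw [integral_finsetSum]
  · have h : ∀ s ∈ Finset.powersetCard k (Finset.univ : Finset (Fin n)),
        ∫ x : Fin n → ℕ, ∏ j, (if (x j = u ↔ j ∈ s) then (1 : ℝ) else 0)
          ∂(Measure.pi fun _ : Fin n => μ) = μ.real {u} ^ k * (1 - μ.real {u}) ^ (n - k) := by
      intro s hs
      rw [Finset.mem_powersetCard_univ] at hs
      rw [integral_fintype_prod_eq_prod (fun (j : Fin n) (y : ℕ) =>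
        if (y = u ↔ j ∈ s) then (1 : ℝ) else 0)]
      simp only [integral_iff_symbol, Finset.prod_ite, Finset.prod_const]
      congr 2
      · simp [hs]
      · rw [← Finset.compl_filter, Finset.card_compl]
        simp [hs]
    rw [Finset.sum_congr rfl h]
    simp
  · intro s _
    refine integrable_sample_of_bound μ 1 fun x => ?_
    rw [Finset.prod_ite_zero]
    split_ifs <;> simp

lemma integral_occInd_mul {n : ℕ} (k l : ℕ) {u v : ℕ} (huv : u ≠ v) :
    ∫ x, occInd k u x * occInd l v x ∂(Measure.pi fun _ : Fin n => μ) =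
      n.choose k * ((n - k).choose l * (μ.real {u} ^ k * (μ.real {v} ^ l *
        (1 - μ.real {u} - μ.real {v}) ^ (n - k - l)))) := by
  simp only [occInd_eq_sum, Finset.sum_mul_sum, ← Finset.prod_mul_distrib]
  have hint : ∀ s t : Finset (Fin n), Integrable (fun x : Fin n → ℕ =>
      ∏ j, ((if (x j = u ↔ j ∈ s) then (1 : ℝ) else 0) * (if (x j = v ↔ j ∈ t) then (1 : ℝ) else 0)))
      (Measure.pi fun _ : Fin n => μ) := by
    intro s t
    refine integrable_sample_of_bound μ 1 fun x => ?_
    rw [Finset.prod_mul_distrib, Finset.prod_ite_zero, Finset.prod_ite_zero]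
    split_ifs <;> simp
  have h : ∀ s ∈ Finset.powersetCard k (Finset.univ : Finset (Fin n)),
      ∀ t ∈ Finset.powersetCard l (Finset.univ : Finset (Fin n)),
      ∫ x : Fin n → ℕ, ∏ j, ((if (x j = u ↔ j ∈ s) then (1 : ℝ) else 0) *
          (if (x j = v ↔ j ∈ t) then (1 : ℝ) else 0)) ∂(Measure.pi fun _ : Fin n => μ) =
        if t ⊆ sᶜ then μ.real {u} ^ k * (μ.real {v} ^ l *
          (1 - μ.real {u} - μ.real {v}) ^ (n - k - l)) else 0 := by
    intro s hs t ht
    rw [Finset.mem_powersetCard_univ] at hs ht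
    rw [integral_fintype_prod_eq_prod (fun (j : Fin n) (y : ℕ) =>
      (if (y = u ↔ j ∈ s) then (1 : ℝ) else 0) * (if (y = v ↔ j ∈ t) then (1 : ℝ) else 0))]
    simp only [integral_iff_mul_iff_symbol μ huv]
    split_ifs with hst
    · have hd : ∀ j ∈ s, j ∉ t := fun j hj hjt => Finset.mem_compl.1 (hst hjt) hj
      rw [Finset.prod_ite, Finset.prod_ite _ _ (s := Finset.univ.filter fun j => j ∉ s)]
      congr 1
      · rw [Finset.prod_congr rfl (g := fun _ => μ.real {u})]
        · simp [hs]
        · intro j hj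
          simp [hd j (by simpa using hj)]
      · have h1 : (Finset.univ.filter fun j => j ∉ s).filter (fun j => j ∈ t) = t := by
          ext j
          simp only [Finset.mem_filter, Finset.mem_univ, true_and, and_iff_right_iff_imp]
          exact fun hj hjs => hd j hjs hj
        have h2 : (Finset.univ.filter fun j => j ∉ s).filter (fun j => j ∉ t) = sᶜ \ t := by
          ext j
          simp
        rw [h1, h2, Finset.prod_const, Finset.prod_const, Finset.card_sdiff_of_subset hst,
          Finset.card_compl, hs, ht, Fintype.card_fin]
    · obtain ⟨j, hjt, hjs⟩ := Finset.not_subset.1 hst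
      refine Finset.prod_eq_zero (Finset.mem_univ j) ?_
      simp_all
  rw [integral_finsetSum _ fun s _ => integrable_finsetSum _ fun t _ => hint s t]
  simp_rw [integral_finsetSum _ fun t _ => hint _ t]
  rw [Finset.sum_congr rfl fun s hs => Finset.sum_congr rfl (h s hs)]
  have hc : ∀ s ∈ Finset.powersetCard k (Finset.univ : Finset (Fin n)),
      (∑ t ∈ Finset.powersetCard l (Finset.univ : Finset (Fin n)),
        if t ⊆ sᶜ then μ.real {u} ^ k * (μ.real {v} ^ l *
          (1 - μ.real {u} - μ.real {v}) ^ (n - k - l)) else 0) =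
      (n - k).choose l * (μ.real {u} ^ k * (μ.real {v} ^ l *
          (1 - μ.real {u} - μ.real {v}) ^ (n - k - l))) := by
    intro s hs
    rw [Finset.mem_powersetCard_univ] at hs
    rw [← Finset.sum_filter, Finset.sum_const, nsmul_eq_mul]
    have : (Finset.powersetCard l (Finset.univ : Finset (Fin n))).filter (fun t => t ⊆ sᶜ) =
        Finset.powersetCard l sᶜ := by
      ext t
      simp [Finset.mem_powersetCard, and_comm]
    rw [this, Finset.card_powersetCard, Finset.card_compl, hs, Fintype.card_fin]
  rw [Finset.sum_congr rfl hc]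
  simp

end Moments

section Bounds

lemma choose_mul_pow_le_one {t : ℝ} (h0 : 0 ≤ t) (h1 : t ≤ 1) {n k : ℕ} (hk : k ≤ n) :
    n.choose k * (t ^ k * (1 - t) ^ (n - k)) ≤ 1 := by
  have h := add_pow t (1 - t) n
  rw [add_sub_cancel, one_pow] at h
  have hs : 0 ≤ 1 - t := sub_nonneg.2 h1
  rw [mul_comm]
  exact (Finset.single_le_sum
    (f := fun m => t ^ m * (1 - t) ^ (n - m) * (n.choose m : ℝ)) (fun i _ => by positivity)
    (Finset.mem_range.2 (Nat.lt_succ_of_le hk))).trans_eq h.symm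

lemma mul_mul_one_sub_pow_le {t : ℝ} (h0 : 0 ≤ t) (h1 : t ≤ 1) (m : ℕ) :
    ((m + 2 : ℕ) : ℝ) * (t * (1 - t) ^ m) ≤ 2 := by
  have h := choose_mul_pow_le_one h0 h1 (n := m + 1) (k := 1) (by omega)
  have hs : 0 ≤ 1 - t := sub_nonneg.2 h1
  have : 0 ≤ (m : ℝ) * (t * (1 - t) ^ m) := by positivity
  simp only [Nat.choose_one_right, pow_one, Nat.add_sub_cancel] at h
  push_cast at h ⊢
  nlinarith

lemma sq_mul_sq_mul_one_sub_pow_le {t : ℝ} (h0 : 0 ≤ t) (h1 : t ≤ 1) (m : ℕ) :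
    ((m + 2 : ℕ) : ℝ) ^ 2 * (t ^ 2 * (1 - t) ^ m) ≤ 4 := by
  have h := choose_mul_pow_le_one h0 h1 (n := m + 2) (k := 2) (by omega)
  have hs : 0 ≤ 1 - t := sub_nonneg.2 h1
  have hX : 0 ≤ t ^ 2 * (1 - t) ^ m := by positivity
  simp only [Nat.cast_choose_two, Nat.add_sub_cancel] at h
  push_cast at h ⊢
  have hm : ((m : ℝ) + 2) ^ 2 ≤ 4 * (((m : ℝ) + 2) * ((m : ℝ) + 2 - 1) / 2) := by
    nlinarith [(Nat.cast_nonneg m : (0 : ℝ) ≤ m)]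
  nlinarith [mul_le_mul_of_nonneg_right hm hX]

lemma abs_offdiag_le {t : ℝ} (h0 : 0 ≤ t) (h1 : t ≤ 1) (m : ℕ) :
    |((m + 2 : ℕ) : ℝ) * (t ^ 2 * (1 - t) ^ m) - (1 - t) ^ m / ((m + 2 : ℕ) : ℝ)| ≤
      11 / ((m + 2 : ℕ) : ℝ) := by
  have h := sq_mul_sq_mul_one_sub_pow_le h0 h1 m
  have hs : 0 ≤ 1 - t := sub_nonneg.2 h1
  have hX : 0 ≤ t ^ 2 * (1 - t) ^ m := by positivity
  have hY : 0 ≤ (1 - t) ^ m := by positivity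
  have hY1 : (1 - t) ^ m ≤ 1 := pow_le_one₀ hs (by linarith)
  have hn : (0 : ℝ) < (m + 2 : ℕ) := by positivity
  generalize ((m + 2 : ℕ) : ℝ) = n at *
  have e : n * (t ^ 2 * (1 - t) ^ m) - (1 - t) ^ m / n =
      (n ^ 2 * (t ^ 2 * (1 - t) ^ m) - (1 - t) ^ m) / n := by field_simp
  rw [e, abs_div, abs_of_pos hn]
  gcongr
  rw [abs_le]
  constructor <;> nlinarith [mul_nonneg (sq_nonneg n) hX]

lemma abs_diag_le {t : ℝ} (h0 : 0 ≤ t) (h1 : t ≤ 1) (m : ℕ) :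
    |(1 - t) ^ (m + 1) / ((m + 2 : ℕ) : ℝ) + t * (1 - t) ^ m -
        ((m + 2 : ℕ) : ℝ) * (t ^ 2 * (1 - t) ^ m) * (2 - t)| ≤ 11 / ((m + 2 : ℕ) : ℝ) := by
  have h := sq_mul_sq_mul_one_sub_pow_le h0 h1 m
  have h' := mul_mul_one_sub_pow_le h0 h1 m
  have hs : 0 ≤ 1 - t := sub_nonneg.2 h1
  have hX : 0 ≤ t ^ 2 * (1 - t) ^ m := by positivity
  have hX' : 0 ≤ t * (1 - t) ^ m := by positivity
  have hY : 0 ≤ (1 - t) ^ (m + 1) := by positivity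
  have hY1 : (1 - t) ^ (m + 1) ≤ 1 := pow_le_one₀ hs (by linarith)
  have hn : (0 : ℝ) < (m + 2 : ℕ) := by positivity
  generalize ((m + 2 : ℕ) : ℝ) = n at *
  have e : (1 - t) ^ (m + 1) / n + t * (1 - t) ^ m - n * (t ^ 2 * (1 - t) ^ m) * (2 - t) =
      ((1 - t) ^ (m + 1) + n * (t * (1 - t) ^ m) -
        n ^ 2 * (t ^ 2 * (1 - t) ^ m) * (2 - t)) / n := by
    field_simp
  rw [e, abs_div, abs_of_pos hn]
  gcongr
  have hZ : 0 ≤ n ^ 2 * (t ^ 2 * (1 - t) ^ m) := by positivity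
  have hZ' : 0 ≤ n * (t * (1 - t) ^ m) := by positivity
  rw [abs_le]
  constructor <;> nlinarith

end Bounds

section Risk

/-- The contribution of the symbol `u` to the error `Φ₁ / n - M₀` of the Good-Turing estimator. -/
def symbolError {n : ℕ} (p : ℕ → ℝ) (u : ℕ) (x : Fin n → ℕ) : ℝ :=
  occInd 1 u x / n - p u * occInd 0 u x

lemma hasSum_missingMass {n : ℕ} {p : ℕ → ℝ} (h0 : ∀ u, 0 ≤ p u) (hp : HasSum p 1)
    (x : Fin n → ℕ) : HasSum (fun u => p u * occInd 0 u x) (missingMass p x) := by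
  have : (fun u => if nOcc x u = 0 then p u else 0) = fun u => p u * occInd 0 u x := by
    ext u; simp [occInd]
  rw [missingMass, this]
  refine (Summable.of_nonneg_of_le (fun u => mul_nonneg (h0 u) (occInd_nonneg _ _ _))
    (fun u => ?_) hp.summable).hasSum
  exact mul_le_of_le_one_right (h0 u) (occInd_le_one _ _ _)

lemma missingMass_nonneg {n : ℕ} {p : ℕ → ℝ} (h0 : ∀ u, 0 ≤ p u) (x : Fin n → ℕ) :
    0 ≤ missingMass p x :=
  tsum_nonneg fun u => by split_ifs <;> simp [h0 u]

lemma missingMass_le_one {n : ℕ} {p : ℕ → ℝ} (h0 : ∀ u, 0 ≤ p u) (hp : HasSum p 1)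
    (x : Fin n → ℕ) : missingMass p x ≤ 1 :=
  hasSum_le (fun u => mul_le_of_le_one_right (h0 u) (occInd_le_one 0 u x))
    (hasSum_missingMass h0 hp x) hp

lemma hasSum_goodTuring {n : ℕ} (x : Fin n → ℕ) :
    HasSum (fun u => occInd 1 u x / n) (goodTuring x) :=
  (hasSum_phi one_ne_zero x).div_const _

lemma goodTuring_nonneg {n : ℕ} (x : Fin n → ℕ) : 0 ≤ goodTuring x := by
  unfold goodTuring; positivity

lemma goodTuring_le_one {n : ℕ} (x : Fin n → ℕ) : goodTuring x ≤ 1 :=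
  div_le_one_of_le₀ (by exact_mod_cast phi_le 1 x) (by positivity)

lemma abs_goodTuring_sub_missingMass_le {n : ℕ} {p : ℕ → ℝ} (h0 : ∀ u, 0 ≤ p u) (hp : HasSum p 1)
    (x : Fin n → ℕ) : |goodTuring x - missingMass p x| ≤ 1 := by
  have := goodTuring_nonneg x
  have := goodTuring_le_one x
  have := missingMass_nonneg h0 x
  have := missingMass_le_one h0 hp x
  rw [abs_le]; constructor <;> linarith

variable (μ : Measure ℕ) [IsProbabilityMeasure μ]

lemma integral_occInd_one_div_le {n : ℕ} (hn : n ≠ 0) (u : ℕ) :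
    ∫ x, occInd 1 u x / n ∂(Measure.pi fun _ : Fin n => μ) ≤ μ.real {u} := by
  have hn' : (0 : ℝ) < n := by positivity
  rw [integral_div, integral_occInd, div_le_iff₀ hn']
  have h0 : 0 ≤ μ.real {u} := measureReal_nonneg
  have h1 : μ.real {u} ≤ 1 := measureReal_le_one
  have : (1 - μ.real {u}) ^ (n - 1) ≤ 1 := pow_le_one₀ (by linarith) (by linarith)
  simp only [Nat.choose_one_right, pow_one]
  nlinarith [mul_le_mul_of_nonneg_left this (mul_nonneg hn'.le h0)]

lemma integrable_symbolError {n : ℕ} (u : ℕ) :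
    Integrable (symbolError (fun u => μ.real {u}) u) (Measure.pi fun _ : Fin n => μ) :=
  ((integrable_occInd μ 1 u).div_const _).sub ((integrable_occInd μ 0 u).const_mul _)

lemma integral_abs_symbolError_le {n : ℕ} (hn : n ≠ 0) (u : ℕ) :
    ∫ x, |symbolError (fun u => μ.real {u}) u x| ∂(Measure.pi fun _ : Fin n => μ) ≤
      2 * μ.real {u} := by
  have h0 : 0 ≤ μ.real {u} := measureReal_nonneg
  calc ∫ x, |symbolError (fun u => μ.real {u}) u x| ∂(Measure.pi fun _ : Fin n => μ)
      ≤ ∫ x, (occInd 1 u x / n + μ.real {u}) ∂(Measure.pi fun _ : Fin n => μ) := by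
        refine integral_mono (integrable_symbolError μ u).abs
          (((integrable_occInd μ 1 u).div_const _).add (integrable_const _)) fun x => ?_
        have ha : 0 ≤ occInd 1 u x / n := div_nonneg (occInd_nonneg _ _ _) (by positivity)
        have hb : 0 ≤ μ.real {u} * occInd 0 u x := mul_nonneg h0 (occInd_nonneg _ _ _)
        have hc : μ.real {u} * occInd 0 u x ≤ μ.real {u} :=
          mul_le_of_le_one_right h0 (occInd_le_one _ _ _)
        simp only [symbolError]
        rw [abs_le]; constructor <;> linarith
    _ ≤ 2 * μ.real {u} := by
        rw [integral_add ((integrable_occInd μ 1 u).div_const _) (integrable_const _)]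
        have := integral_occInd_one_div_le μ hn u
        simp only [integral_const, probReal_univ, one_smul]
        linarith

lemma integral_symbolError_mul {n : ℕ} (u v : ℕ) :
    ∫ x, symbolError (fun u => μ.real {u}) u x * symbolError (fun u => μ.real {u}) v x
        ∂(Measure.pi fun _ : Fin n => μ) =
      (∫ x, occInd 1 u x * occInd 1 v x ∂(Measure.pi fun _ : Fin n => μ)) / n ^ 2
        - μ.real {v} / n * (∫ x, occInd 1 u x * occInd 0 v x ∂(Measure.pi fun _ : Fin n => μ))
        - μ.real {u} / n * (∫ x, occInd 1 v x * occInd 0 u x ∂(Measure.pi fun _ : Fin n => μ))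
        + μ.real {u} * μ.real {v} *
          ∫ x, occInd 0 u x * occInd 0 v x ∂(Measure.pi fun _ : Fin n => μ) := by
  have i1 := (integrable_occInd_mul μ (n := n) 1 u 1 v).div_const ((n : ℝ) ^ 2)
  have i2 := (integrable_occInd_mul μ (n := n) 1 u 0 v).const_mul (μ.real {v} / n)
  have i3 := (integrable_occInd_mul μ (n := n) 1 v 0 u).const_mul (μ.real {u} / n)
  have i4 := (integrable_occInd_mul μ (n := n) 0 u 0 v).const_mul (μ.real {u} * μ.real {v})
  rw [← integral_div, ← integral_const_mul, ← integral_const_mul, ← integral_const_mul,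
    ← integral_sub' i1 i2, ← integral_sub' (i1.sub i2) i3, ← integral_add' ((i1.sub i2).sub i3) i4]
  congr 1
  ext x
  simp only [symbolError, Pi.sub_apply, Pi.add_apply]
  ring

/-- Contribution of a pair of distinct symbols to `n R_n + E[(Φ₁ / n)²]`. -/
lemma integral_pair_of_ne (m : ℕ) {u v : ℕ} (huv : u ≠ v) :
    ((m + 2 : ℕ) : ℝ) *
        (∫ x, symbolError (fun u => μ.real {u}) u x * symbolError (fun u => μ.real {u}) v x
          ∂(Measure.pi fun _ : Fin (m + 2) => μ)) +
      ∫ x, occInd 1 u x / (m + 2 : ℕ) * (occInd 1 v x / (m + 2 : ℕ))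
        ∂(Measure.pi fun _ : Fin (m + 2) => μ) =
    μ.real {u} * μ.real {v} * (((m + 2 : ℕ) : ℝ) * ((μ.real {u} + μ.real {v}) ^ 2 *
      (1 - (μ.real {u} + μ.real {v})) ^ m) - (1 - (μ.real {u} + μ.real {v})) ^ m / (m + 2 : ℕ)) := by
  have hn : ((m + 2 : ℕ) : ℝ) ≠ 0 := by positivity
  have e : ∀ x : Fin (m + 2) → ℕ, occInd 1 u x / (m + 2 : ℕ) * (occInd 1 v x / (m + 2 : ℕ)) =
      occInd 1 u x * occInd 1 v x / ((m + 2 : ℕ) : ℝ) ^ 2 := fun x => by ring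
  simp only [e]
  rw [integral_div, integral_symbolError_mul, integral_occInd_mul μ 1 1 huv,
    integral_occInd_mul μ 1 0 huv, integral_occInd_mul μ 1 0 huv.symm,
    integral_occInd_mul μ 0 0 huv]
  have e1 : m + 2 - 1 = m + 1 := by omega
  have e2 : m + 1 - 1 = m := by omega
  simp only [Nat.choose_one_right, Nat.choose_zero_right, pow_one, pow_zero, Nat.sub_zero, e1, e2,
    Nat.cast_one, one_mul]
  rw [sub_sub 1, sub_sub 1 (μ.real {v}), add_comm (μ.real {v}) (μ.real {u})]
  have hm : ((m + 1 : ℕ) : ℝ) = ((m + 2 : ℕ) : ℝ) - 1 := by push_cast; ring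
  rw [hm]
  generalize ((m + 2 : ℕ) : ℝ) = n at *
  generalize μ.real {u} = a
  generalize μ.real {v} = b
  rw [pow_add _ m 1, pow_add _ m 2]
  generalize (1 - (a + b)) ^ m = q
  field_simp
  ring

/-- Contribution of a repeated symbol to `n R_n - E[2 Φ₂ / n + (Φ₁ / n) (1 - Φ₁ / n)]`. -/
lemma integral_pair_self (m u : ℕ) :
    ((m + 2 : ℕ) : ℝ) *
        (∫ x, symbolError (fun u => μ.real {u}) u x * symbolError (fun u => μ.real {u}) u x
          ∂(Measure.pi fun _ : Fin (m + 2) => μ)) +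
      (∫ x, occInd 1 u x / (m + 2 : ℕ) * (occInd 1 u x / (m + 2 : ℕ))
        ∂(Measure.pi fun _ : Fin (m + 2) => μ)) -
      ((∫ x, 2 * occInd 2 u x / (m + 2 : ℕ) ∂(Measure.pi fun _ : Fin (m + 2) => μ)) +
        ∫ x, occInd 1 u x / (m + 2 : ℕ) ∂(Measure.pi fun _ : Fin (m + 2) => μ)) =
    μ.real {u} * ((1 - μ.real {u}) ^ (m + 1) / (m + 2 : ℕ) + μ.real {u} * (1 - μ.real {u}) ^ m -
        ((m + 2 : ℕ) : ℝ) * (μ.real {u} ^ 2 * (1 - μ.real {u}) ^ m) * (2 - μ.real {u})) := by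
  have hn : ((m + 2 : ℕ) : ℝ) ≠ 0 := by positivity
  have e : ∀ x : Fin (m + 2) → ℕ, occInd 1 u x / (m + 2 : ℕ) * (occInd 1 u x / (m + 2 : ℕ)) =
      occInd 1 u x / ((m + 2 : ℕ) : ℝ) ^ 2 := fun x => by
    rw [div_mul_div_comm, occInd_mul_self, sq]
  simp only [e]
  rw [integral_symbolError_mul]
  simp only [occInd_mul_self, occInd_mul_of_ne one_ne_zero, integral_div, integral_const_mul,
    integral_occInd, integral_zero]
  have e1 : m + 2 - 1 = m + 1 := by omega
  have e2 : m + 2 - 2 = m := by omega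
  simp only [Nat.choose_one_right, Nat.choose_zero_right, pow_one, pow_zero, Nat.sub_zero, e1, e2,
    Nat.cast_one, one_mul, Nat.cast_choose_two]
  generalize ((m + 2 : ℕ) : ℝ) = n at *
  generalize μ.real {u} = a
  rw [pow_add _ m 1, pow_add _ m 2]
  generalize (1 - a) ^ m = q
  field_simp
  ring

lemma abs_symbolError_le_one {n : ℕ} (u : ℕ) (x : Fin n → ℕ) :
    |symbolError (fun u => μ.real {u}) u x| ≤ 1 := by
  have h0 : 0 ≤ μ.real {u} := measureReal_nonneg
  have h1 : μ.real {u} ≤ 1 := measureReal_le_one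
  have ha : 0 ≤ occInd 1 u x / n := div_nonneg (occInd_nonneg _ _ _) (by positivity)
  have ha' : occInd 1 u x / n ≤ 1 :=
    (le_hasSum (hasSum_goodTuring x) u fun v _ =>
      div_nonneg (occInd_nonneg _ _ _) (by positivity)).trans (goodTuring_le_one x)
  have hb : 0 ≤ μ.real {u} * occInd 0 u x := mul_nonneg h0 (occInd_nonneg _ _ _)
  have hc : μ.real {u} * occInd 0 u x ≤ μ.real {u} :=
    mul_le_of_le_one_right h0 (occInd_le_one _ _ _)
  simp only [symbolError]
  rw [abs_le]; constructor <;> linarith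

/-- Fixing one symbol of the pair, the contributions to
`n R_n - E[2 Φ₂ / n + (Φ₁ / n) (1 - Φ₁ / n)]` sum to `O(p(u) / n)`. -/
lemma abs_le_of_hasSum_pair (hp : HasSum (fun u => μ.real {u}) 1) (m u : ℕ) {r s : ℝ}
    (hr : HasSum (fun v => ∫ x, symbolError (fun u => μ.real {u}) u x *
      symbolError (fun u => μ.real {u}) v x ∂(Measure.pi fun _ : Fin (m + 2) => μ)) r)
    (hs : HasSum (fun v => ∫ x, occInd 1 u x / (m + 2 : ℕ) * (occInd 1 v x / (m + 2 : ℕ))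
      ∂(Measure.pi fun _ : Fin (m + 2) => μ)) s) :
    |((m + 2 : ℕ) : ℝ) * r + s -
      ((∫ x, 2 * occInd 2 u x / (m + 2 : ℕ) ∂(Measure.pi fun _ : Fin (m + 2) => μ)) +
        ∫ x, occInd 1 u x / (m + 2 : ℕ) ∂(Measure.pi fun _ : Fin (m + 2) => μ))| ≤
      μ.real {u} * (22 / (m + 2 : ℕ)) := by
  have h := ((hr.mul_left ((m + 2 : ℕ) : ℝ)).add hs).sub (hasSum_ite_eq u
    ((∫ x, 2 * occInd 2 u x / (m + 2 : ℕ) ∂(Measure.pi fun _ : Fin (m + 2) => μ)) +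
        ∫ x, occInd 1 u x / (m + 2 : ℕ) ∂(Measure.pi fun _ : Fin (m + 2) => μ)))
  have hg := (hp.mul_left (μ.real {u} * (11 / (m + 2 : ℕ)))).add
    (hasSum_ite_eq u (μ.real {u} * (11 / (m + 2 : ℕ))))
  refine (h.norm_le_of_bounded hg fun v => ?_).trans (le_of_eq (by ring))
  have hu0 : 0 ≤ μ.real {u} := measureReal_nonneg
  have hv0 : 0 ≤ μ.real {v} := measureReal_nonneg
  rw [Real.norm_eq_abs]
  split_ifs with hvu
  · subst hvu
    rw [integral_pair_self, abs_mul, abs_of_nonneg hv0]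
    have := mul_le_mul_of_nonneg_left (abs_diag_le hv0 (measureReal_le_one (μ := μ)) m) hv0
    refine this.trans (le_add_of_nonneg_left (by positivity))
  · have huv : u ≠ v := fun h => hvu h.symm
    have h1 : μ.real {u} + μ.real {v} ≤ 1 := by
      rw [← Finset.sum_pair huv (f := fun u => μ.real {u})]
      exact sum_le_hasSum _ (fun _ _ => measureReal_nonneg) hp
    rw [sub_zero, add_zero, integral_pair_of_ne μ m huv, abs_mul, abs_of_nonneg (by positivity)]
    refine (mul_le_mul_of_nonneg_left (abs_offdiag_le (by positivity) h1 m)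
      (by positivity)).trans (le_of_eq (by ring))

lemma integral_occInd_two_div_le {n : ℕ} (u : ℕ) :
    ∫ x, 2 * occInd 2 u x / n ∂(Measure.pi fun _ : Fin n => μ) ≤
      2 * n.choose 2 / n * μ.real {u} := by
  have h0 : 0 ≤ μ.real {u} := measureReal_nonneg
  have h1 : μ.real {u} ≤ 1 := measureReal_le_one
  have hq : (1 - μ.real {u}) ^ (n - 2) ≤ 1 := pow_le_one₀ (by linarith) (by linarith)
  have hq0 : 0 ≤ (1 - μ.real {u}) ^ (n - 2) := pow_nonneg (by linarith) _
  rw [integral_div, integral_const_mul, integral_occInd]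
  have : μ.real {u} ^ 2 * (1 - μ.real {u}) ^ (n - 2) ≤ μ.real {u} := by
    calc μ.real {u} ^ 2 * (1 - μ.real {u}) ^ (n - 2) ≤ μ.real {u} ^ 2 * 1 := by gcongr
      _ ≤ μ.real {u} := by nlinarith
  calc 2 * (n.choose 2 * (μ.real {u} ^ 2 * (1 - μ.real {u}) ^ (n - 2))) / n
      ≤ 2 * (n.choose 2 * μ.real {u}) / n := by gcongr
    _ = 2 * n.choose 2 / n * μ.real {u} := by ring

lemma integrable_goodTuring_target {n : ℕ} :
    Integrable (fun x : Fin n → ℕ => 2 * (phi 2 x : ℝ) / n +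
      ((phi 1 x : ℝ) / n) * (1 - (phi 1 x : ℝ) / n)) (Measure.pi fun _ : Fin n => μ) := by
  refine integrable_sample_of_bound μ 3 fun x => ?_
  have h1 := goodTuring_nonneg x
  have h2 := goodTuring_le_one x
  have h3 : (phi 2 x : ℝ) / n ≤ 1 :=
    div_le_one_of_le₀ (by exact_mod_cast phi_le 2 x) (by positivity)
  have h4 : 0 ≤ (phi 2 x : ℝ) / n := by positivity
  unfold goodTuring at h1 h2
  rw [abs_le, mul_div_assoc]; constructor <;> nlinarith

lemma integrable_sq_goodTuring_sub_missingMass (hp : HasSum (fun u => μ.real {u}) 1) {n : ℕ} :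
    Integrable (fun x : Fin n → ℕ => (goodTuring x - missingMass (fun u => μ.real {u}) x) ^ 2)
      (Measure.pi fun _ : Fin n => μ) := by
  refine integrable_sample_of_bound μ 1 fun x => ?_
  rw [abs_pow]
  exact pow_le_one₀ (abs_nonneg _)
    (abs_goodTuring_sub_missingMass_le (fun u => measureReal_nonneg) hp x)

lemma abs_integral_goodTuring_le (hp : HasSum (fun u => μ.real {u}) 1) (m : ℕ) :
    |((m + 2 : ℕ) : ℝ) * (∫ x, (goodTuring x - missingMass (fun u => μ.real {u}) x) ^ 2
        ∂(Measure.pi fun _ : Fin (m + 2) => μ)) -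
      ∫ x, (2 * (phi 2 x : ℝ) / (m + 2 : ℕ) +
        ((phi 1 x : ℝ) / (m + 2 : ℕ)) * (1 - (phi 1 x : ℝ) / (m + 2 : ℕ)))
        ∂(Measure.pi fun _ : Fin (m + 2) => μ)| ≤ 22 / (m + 2 : ℕ) := by
  have hn : m + 2 ≠ 0 := by omega
  have hp0 : ∀ u, 0 ≤ μ.real {u} := fun u => measureReal_nonneg
  have hE : ∀ x : Fin (m + 2) → ℕ, HasSum (fun u => symbolError (fun u => μ.real {u}) u x)
      (goodTuring x - missingMass (fun u => μ.real {u}) x) := fun x =>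
    (hasSum_goodTuring x).sub (hasSum_missingMass hp0 hp x)
  have hB0 : ∀ u (x : Fin (m + 2) → ℕ), 0 ≤ occInd 1 u x / (m + 2 : ℕ) := fun u x =>
    div_nonneg (occInd_nonneg _ _ _) (by positivity)
  have hB1 : ∀ u (x : Fin (m + 2) → ℕ), |occInd 1 u x / (m + 2 : ℕ)| ≤ 1 := fun u x => by
    rw [abs_of_nonneg (hB0 u x)]
    exact (le_hasSum (hasSum_goodTuring x) u fun v _ => hB0 v x).trans (goodTuring_le_one x)
  have hBi : ∀ u, Integrable (fun x => occInd 1 u x / (m + 2 : ℕ))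
      (Measure.pi fun _ : Fin (m + 2) => μ) := fun u => (integrable_occInd μ 1 u).div_const _
  have hBb : ∀ u, ∫ x, |occInd 1 u x / (m + 2 : ℕ)| ∂(Measure.pi fun _ : Fin (m + 2) => μ) ≤
      μ.real {u} := fun u => by
    simp only [abs_of_nonneg (hB0 u _)]
    exact integral_occInd_one_div_le μ hn u
  have hG1 : ∀ x : Fin (m + 2) → ℕ, |goodTuring x| ≤ 1 := fun x => by
    rw [abs_of_nonneg (goodTuring_nonneg x)]; exact goodTuring_le_one x
  have hC0 : ∀ u (x : Fin (m + 2) → ℕ), 0 ≤ 2 * occInd 2 u x / (m + 2 : ℕ) := fun u x =>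
    div_nonneg (mul_nonneg zero_le_two (occInd_nonneg _ _ _)) (by positivity)
  have hEE := hasSum_integral_mul μ hE
    (abs_goodTuring_sub_missingMass_le (n := m + 2) hp0 hp)
    (integrable_symbolError μ) (hp.summable.mul_left 2) (integral_abs_symbolError_le μ hn)
  have hE_ := fun u => hasSum_integral_mul μ hE (abs_symbolError_le_one (n := m + 2) μ u)
    (integrable_symbolError μ) (hp.summable.mul_left 2) (integral_abs_symbolError_le μ hn)
  have hGG := hasSum_integral_mul μ hasSum_goodTuring hG1 hBi hp.summable hBb
  have hG_ := fun u => hasSum_integral_mul μ hasSum_goodTuring (hB1 u) hBi hp.summable hBb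
  have hG := hasSum_integral_mul μ (W := fun _ => 1) (C := 1) hasSum_goodTuring (by simp)
    hBi hp.summable hBb
  have hC := hasSum_integral_mul μ (W := fun _ => 1) (C := 1)
    (fun x : Fin (m + 2) → ℕ =>
      ((hasSum_phi two_ne_zero x).mul_left 2).div_const ((m + 2 : ℕ) : ℝ)) (by simp)
    (fun u => ((integrable_occInd μ 2 u).const_mul 2).div_const _)
    (hp.summable.mul_left (2 * (m + 2).choose 2 / ((m + 2 : ℕ) : ℝ)))
    (fun u => by
      simp only [abs_of_nonneg (hC0 u _)]
      exact integral_occInd_two_div_le μ u)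
  simp only [one_mul] at hG hC
  have htot := ((hEE.mul_left ((m + 2 : ℕ) : ℝ)).add hGG).sub (hC.add hG)
  have hbound := htot.norm_le_of_bounded (hp.mul_right (22 / ((m + 2 : ℕ) : ℝ))) fun u => by
    have h := abs_le_of_hasSum_pair μ hp m u (hE_ u) (hG_ u)
    simpa only [Real.norm_eq_abs, mul_comm (symbolError _ _ _) (_ - _),
      mul_comm (_ / _) (goodTuring _)] using h
  rw [one_mul, Real.norm_eq_abs] at hbound
  refine (le_of_eq ?_).trans hbound
  congr 1
  rw [add_sub_assoc, sub_eq_add_neg]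
  simp only [sq]
  congr 1
  have hCi : Integrable (fun x : Fin (m + 2) → ℕ => 2 * (phi 2 x : ℝ) / (m + 2 : ℕ))
      (Measure.pi fun _ : Fin (m + 2) => μ) := by
    refine integrable_sample_of_bound μ 2 fun x => ?_
    rw [abs_of_nonneg (by positivity), mul_div_assoc]
    have : (phi 2 x : ℝ) / (m + 2 : ℕ) ≤ 1 :=
      div_le_one_of_le₀ (by exact_mod_cast phi_le 2 x) (by positivity)
    linarith
  have hGi : Integrable (goodTuring (n := m + 2)) (Measure.pi fun _ : Fin (m + 2) => μ) :=
    integrable_sample_of_bound μ 1 hG1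
  have hGGi : Integrable (fun x : Fin (m + 2) → ℕ => goodTuring x * goodTuring x)
      (Measure.pi fun _ : Fin (m + 2) => μ) :=
    hGi.bdd_mul (measurable_of_sample _).aestronglyMeasurable (ae_of_all _ hG1)
  rw [← integral_add' hCi hGi, ← integral_sub' hGGi (hCi.add hGi), ← integral_neg]
  congr 1
  ext x
  simp only [Pi.sub_apply, Pi.add_apply, goodTuring]
  ring

end Risk

/-- The probability mass function `p` as a `PMF`. -/
def IsPMF.toPMF {p : ℕ → ℝ} (hp : IsPMF p) : PMF ℕ :=
  ⟨fun u => ENNReal.ofReal (p u), by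
    rw [ENNReal.summable.hasSum_iff, ← ENNReal.ofReal_tsum_of_nonneg hp.1 hp.2.summable,
      hp.2.tsum_eq, ENNReal.ofReal_one]⟩

lemma IsPMF.toPMF_toMeasure_real_singleton {p : ℕ → ℝ} (hp : IsPMF p) (u : ℕ) :
    hp.toPMF.toMeasure.real {u} = p u := by
  rw [Measure.real, PMF.toMeasure_apply_singleton _ _ (measurableSet_singleton u)]
  exact ENNReal.toReal_ofReal (hp.1 u)

lemma expct_eq_integral {n : ℕ} {μ : Measure ℕ} [IsProbabilityMeasure μ] {f : (Fin n → ℕ) → ℝ}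
    (hf : Integrable f (Measure.pi fun _ : Fin n => μ)) :
    expct n (fun u => μ.real {u}) f = ∫ x, f x ∂(Measure.pi fun _ : Fin n => μ) := by
  rw [integral_countable hf]
  refine tsum_congr fun x => ?_
  rw [smul_eq_mul, Measure.real, Measure.pi_singleton, ENNReal.toReal_prod]
  rfl

/-- **Theorem 1 (risk of the Good-Turing estimator, uniform `o(1/n)` form).**
There is a sequence `ε_n ≥ 0` with `ε_n → 0` such that for every `n ≥ 2` and every
pmf `p` on `ℕ`,
`|n R_n(M^GT, p) - E[2Φ₂/n + (Φ₁/n)(1 - Φ₁/n)]| ≤ ε_n`. -/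
theorem goodTuring_risk_asymptotic :
    ∃ ε : ℕ → ℝ, (∀ n, 0 ≤ ε n) ∧
      Filter.Tendsto ε Filter.atTop (nhds 0) ∧
      ∀ n : ℕ, 2 ≤ n → ∀ p : ℕ → ℝ, IsPMF p →
        |(n : ℝ) * risk n p goodTuring -
            expct n p (fun x =>
              2 * (phi 2 x : ℝ) / n +
                ((phi 1 x : ℝ) / n) * (1 - (phi 1 x : ℝ) / n))| ≤ ε n := by
  refine ⟨fun n => 22 / n, fun n => by positivity, tendsto_const_div_atTop_nhds_zero_nat 22,
    fun n hn p hp => ?_⟩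
  obtain ⟨m, rfl⟩ : ∃ m, n = m + 2 := ⟨n - 2, by omega⟩
  obtain ⟨μ, _, rfl⟩ : ∃ μ : Measure ℕ, IsProbabilityMeasure μ ∧ p = fun u => μ.real {u} :=
    ⟨hp.toPMF.toMeasure, inferInstance,
      funext fun u => (hp.toPMF_toMeasure_real_singleton u).symm⟩
  rw [risk, expct_eq_integral (integrable_sq_goodTuring_sub_missingMass μ hp.2),
    expct_eq_integral (integrable_goodTuring_target μ)]
  exact abs_integral_goodTuring_le μ hp.2 m
end
end

section
/- Let 𝒫 be the set of probability mass functions p on {0,1} with p(0) ≥ 1/2. Then the minimax squared-error risk for estimating p(0) from n i.i.d. samples satisfies lim_{n→∞} n·inf_{p̂} sup_{p ∈ 𝒫} E_{X^n ∼ p^{⊗n}}[(p(0) − p̂(X^n))²] = 1/4, where the infimum is over all estimators p̂ : {0,1}^n → [0,1]. -/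
open scoped BigOperators

noncomputable section

/-- The minimax squared-error risk, with `n` samples, for estimating `p(0)` over the
class of pmfs `p` on `{0,1}` with `p(0) ≥ 1/2`; the infimum is over all estimators
`p̂ : {0,1}^n → [0,1]`. -/
def minimaxBernoulli (n : ℕ) : ℝ :=
  sInf {r : ℝ | ∃ phat : (Fin n → Fin 2) → ℝ, (∀ x, phat x ∈ Set.Icc (0 : ℝ) 1) ∧
    r = sSup {s : ℝ | ∃ q : Fin 2 → ℝ, (∀ u, 0 ≤ q u) ∧ (∑ u, q u) = 1 ∧
          1 / 2 ≤ q 0 ∧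
          s = ∑ x : Fin n → Fin 2, (∏ i, q (x i)) * (q 0 - phat x) ^ 2}}

/-- The first three moments of a sum of centred i.i.d. terms under a product weight. -/
lemma product_weight_moments (w f : Fin 2 → ℝ) (hw : ∑ u, w u = 1) (hf : ∑ u, w u * f u = 0)
    (n : ℕ) :
    (∑ x : Fin n → Fin 2, ∏ i, w (x i)) = 1 ∧
    (∑ x : Fin n → Fin 2, (∏ i, w (x i)) * ∑ i, f (x i)) = 0 ∧
    (∑ x : Fin n → Fin 2, (∏ i, w (x i)) * (∑ i, f (x i)) ^ 2) = n * ∑ u, w u * f u ^ 2 := by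
  induction n with
  | zero => simp
  | succ n ih =>
    obtain ⟨h0, h1, h2⟩ := ih
    have key : ∀ F : (Fin (n + 1) → Fin 2) → ℝ,
        ∑ x, F x = ∑ u : Fin 2, ∑ y : Fin n → Fin 2, F (Fin.cons u y) := by
      intro F
      rw [← (Fin.consEquiv (fun _ : Fin (n + 1) => Fin 2)).sum_comp, Fintype.sum_prod_type]
      rfl
    simp only [Fin.sum_univ_two] at hw hf
    refine ⟨?_, ?_, ?_⟩
    · rw [key]
      simp only [Fin.prod_univ_succ, Fin.cons_zero, Fin.cons_succ, ← Finset.mul_sum, h0,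
        Fin.sum_univ_two]
      linarith
    · rw [key]
      have : ∀ u : Fin 2, ∑ y : Fin n → Fin 2,
          (w u * ∏ i, w (y i)) * (f u + ∑ i, f (y i)) = w u * f u := by
        intro u
        calc _ = w u * f u * (∑ y : Fin n → Fin 2, ∏ i, w (y i))
              + w u * ∑ y : Fin n → Fin 2, (∏ i, w (y i)) * ∑ i, f (y i) := by
              rw [Finset.mul_sum, Finset.mul_sum, ← Finset.sum_add_distrib]
              exact Finset.sum_congr rfl fun y _ => by ring
          _ = _ := by rw [h0, h1]; ring
      simp only [Fin.prod_univ_succ, Fin.sum_univ_succ (n := n), Fin.cons_zero, Fin.cons_succ,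
        this]
      simpa [Fin.sum_univ_two] using hf
    · rw [key]
      have : ∀ u : Fin 2, ∑ y : Fin n → Fin 2,
          (w u * ∏ i, w (y i)) * (f u + ∑ i, f (y i)) ^ 2
            = w u * f u ^ 2 + w u * (n * ∑ u, w u * f u ^ 2) := by
        intro u
        calc _ = w u * f u ^ 2 * (∑ y : Fin n → Fin 2, ∏ i, w (y i))
              + 2 * w u * f u * (∑ y : Fin n → Fin 2, (∏ i, w (y i)) * ∑ i, f (y i))
              + w u * ∑ y : Fin n → Fin 2, (∏ i, w (y i)) * (∑ i, f (y i)) ^ 2 := by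
              rw [Finset.mul_sum, Finset.mul_sum, Finset.mul_sum, ← Finset.sum_add_distrib,
                ← Finset.sum_add_distrib]
              exact Finset.sum_congr rfl fun y _ => by ring
          _ = _ := by rw [h0, h1, h2]; ring
      simp only [Fin.prod_univ_succ, Fin.sum_univ_succ (n := n), Fin.cons_zero, Fin.cons_succ,
        this]
      rw [Finset.sum_add_distrib, ← Finset.sum_mul, Fin.sum_univ_two w, hw]
      push_cast
      ring

/-- The pmf on `{0,1}` with mass `q` at `0`. -/
def bernoulliWeight (q : ℝ) (u : Fin 2) : ℝ := if u = 0 then q else 1 - q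

/-- The indicator of `0`, centred at its mean `q`. -/
def centredIndicator (q : ℝ) (u : Fin 2) : ℝ := (if u = 0 then 1 else 0) - q

/-- The squared-error risk of `phat` at the pmf with mass `q` at `0`. -/
def bernoulliRisk {n : ℕ} (phat : (Fin n → Fin 2) → ℝ) (q : ℝ) : ℝ :=
  ∑ x, (∏ i, bernoulliWeight q (x i)) * (q - phat x) ^ 2

lemma bernoulliWeight_nonneg {q : ℝ} (h0 : 0 ≤ q) (h1 : q ≤ 1) (u : Fin 2) :
    0 ≤ bernoulliWeight q u := by
  unfold bernoulliWeight
  split_ifs <;> linarith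

lemma bernoulli_moments (q : ℝ) (n : ℕ) :
    (∑ x : Fin n → Fin 2, ∏ i, bernoulliWeight q (x i)) = 1 ∧
    (∑ x : Fin n → Fin 2, (∏ i, bernoulliWeight q (x i)) * ∑ i, centredIndicator q (x i)) = 0 ∧
    (∑ x : Fin n → Fin 2, (∏ i, bernoulliWeight q (x i)) * (∑ i, centredIndicator q (x i)) ^ 2)
      = n * (q * (1 - q)) := by
  have h := product_weight_moments (bernoulliWeight q) (centredIndicator q)
    (by simp [bernoulliWeight]) (by simp [bernoulliWeight, centredIndicator]; ring) n
  refine ⟨h.1, h.2.1, h.2.2.trans ?_⟩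
  simp [bernoulliWeight, centredIndicator]
  left
  ring

lemma risk_set_eq {n : ℕ} (phat : (Fin n → Fin 2) → ℝ) :
    {s : ℝ | ∃ q : Fin 2 → ℝ, (∀ u, 0 ≤ q u) ∧ (∑ u, q u) = 1 ∧ 1 / 2 ≤ q 0 ∧
      s = ∑ x : Fin n → Fin 2, (∏ i, q (x i)) * (q 0 - phat x) ^ 2}
    = bernoulliRisk phat '' Set.Icc (1 / 2) 1 := by
  ext s
  constructor
  · rintro ⟨q, hq, hsum, hhalf, rfl⟩
    rw [Fin.sum_univ_two] at hsum
    have hqw : q = bernoulliWeight (q 0) := by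
      ext u
      fin_cases u
      · simp [bernoulliWeight]
      · simp [bernoulliWeight]
        linarith
    refine ⟨q 0, ⟨hhalf, by linarith [hq 1]⟩, ?_⟩
    rw [bernoulliRisk, ← hqw]
  · rintro ⟨q, ⟨h0, h1⟩, rfl⟩
    exact ⟨bernoulliWeight q, bernoulliWeight_nonneg (by linarith) h1,
      by simp [bernoulliWeight], by simpa [bernoulliWeight] using h0,
      by simp [bernoulliRisk, bernoulliWeight]⟩

lemma bernoulliRisk_nonneg {n : ℕ} (phat : (Fin n → Fin 2) → ℝ) {q : ℝ} (h0 : 0 ≤ q)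
    (h1 : q ≤ 1) : 0 ≤ bernoulliRisk phat q :=
  Finset.sum_nonneg fun _ _ => mul_nonneg
    (Finset.prod_nonneg fun _ _ => bernoulliWeight_nonneg h0 h1 _) (sq_nonneg _)

lemma bernoulliRisk_le_one {n : ℕ} {phat : (Fin n → Fin 2) → ℝ}
    (hp : ∀ x, phat x ∈ Set.Icc (0 : ℝ) 1) {q : ℝ} (h0 : 0 ≤ q) (h1 : q ≤ 1) :
    bernoulliRisk phat q ≤ 1 := by
  rw [← (bernoulli_moments q n).1]
  refine Finset.sum_le_sum fun x _ => mul_le_of_le_one_right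
    (Finset.prod_nonneg fun _ _ => bernoulliWeight_nonneg h0 h1 _) ?_
  obtain ⟨ha, hb⟩ := hp x
  rw [sq_le_one_iff_abs_le_one, abs_le]
  constructor <;> linarith

lemma minimaxBernoulli_eq (n : ℕ) :
    minimaxBernoulli n = sInf {r : ℝ | ∃ phat : (Fin n → Fin 2) → ℝ,
      (∀ x, phat x ∈ Set.Icc (0 : ℝ) 1) ∧
        r = sSup (bernoulliRisk phat '' Set.Icc (1 / 2) 1)} := by
  simp only [minimaxBernoulli, risk_set_eq]

lemma mul_minimaxBernoulli_le (n : ℕ) : n * minimaxBernoulli n ≤ 1 / 4 := by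
  rcases Nat.eq_zero_or_pos n with rfl | hn
  · norm_num
  have hn' : (0 : ℝ) < n := by exact_mod_cast hn
  suffices h : minimaxBernoulli n ≤ 1 / 4 / n by
    rw [mul_comm]
    exact (le_div_iff₀ hn').1 h
  rw [minimaxBernoulli_eq]
  let mean : (Fin n → Fin 2) → ℝ := fun x => (∑ i, if x i = 0 then 1 else 0) / n
  refine le_trans (b := sSup (bernoulliRisk mean '' Set.Icc (1 / 2) 1))
    (csInf_le ⟨0, ?_⟩ ⟨mean, ?_, rfl⟩) ?_
  · rintro r ⟨phat, -, rfl⟩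
    refine Real.sSup_nonneg ?_
    rintro _ ⟨q, ⟨h0, h1⟩, rfl⟩
    exact bernoulliRisk_nonneg phat (by linarith) h1
  · intro x
    refine ⟨div_nonneg (Finset.sum_nonneg fun i _ => by split_ifs <;> norm_num) hn'.le, ?_⟩
    rw [div_le_one hn']
    calc (∑ i, if x i = 0 then (1 : ℝ) else 0) ≤ ∑ _i : Fin n, (1 : ℝ) :=
          Finset.sum_le_sum fun i _ => by split_ifs <;> norm_num
      _ = n := by simp
  · refine Real.sSup_le ?_ (by positivity)
    rintro _ ⟨q, -, rfl⟩
    have : bernoulliRisk mean q = (n * (q * (1 - q))) / n ^ 2 := by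
      rw [← (bernoulli_moments q n).2.2, bernoulliRisk, Finset.sum_div]
      refine Finset.sum_congr rfl fun x _ => ?_
      have : ∑ i, centredIndicator q (x i) = n * (mean x - q) := by
        simp only [centredIndicator, Finset.sum_sub_distrib, mean]
        simp
        field_simp
      rw [this]
      field_simp
      ring
    rw [this, div_le_div_iff₀ (by positivity) hn']
    nlinarith [mul_nonneg (sq_nonneg (n : ℝ)) (sq_nonneg (q - 1 / 2))]

/-- The expectation of `phat` at the pmf with mass `q` at `0`. -/
def bernoulliMean {n : ℕ} (phat : (Fin n → Fin 2) → ℝ) (q : ℝ) : ℝ :=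
  ∑ x, (∏ i, bernoulliWeight q (x i)) * phat x

/-- The derivative of the likelihood is the likelihood times the score. -/
lemma hasDerivAt_likelihood {n : ℕ} (x : Fin n → Fin 2) {q : ℝ} (h0 : 0 < q) (h1 : q < 1) :
    HasDerivAt (fun q => ∏ i, bernoulliWeight q (x i))
      ((∏ i, bernoulliWeight q (x i)) * (∑ i, centredIndicator q (x i)) / (q * (1 - q))) q := by
  have hw : ∀ u : Fin 2, HasDerivAt (fun q => bernoulliWeight q u)
      (bernoulliWeight q u * (centredIndicator q u / (q * (1 - q)))) q := by
    have h1' : 1 - q ≠ 0 := by linarith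
    intro u
    unfold bernoulliWeight centredIndicator
    split_ifs with h
    · refine (hasDerivAt_id' q).congr_deriv ?_
      field_simp
    · refine ((hasDerivAt_id' q).const_sub 1).congr_deriv ?_
      field_simp
      ring
  refine (HasDerivAt.fun_finsetProd (u := Finset.univ) (fun i _ => hw (x i))).congr_deriv ?_
  rw [mul_div_assoc, Finset.sum_div, Finset.mul_sum]
  refine Finset.sum_congr rfl fun i hi => ?_
  rw [← Finset.prod_erase_mul _ _ hi, smul_eq_mul, mul_assoc]

lemma hasDerivAt_bernoulliMean {n : ℕ} (phat : (Fin n → Fin 2) → ℝ) {q : ℝ} (h0 : 0 < q)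
    (h1 : q < 1) :
    HasDerivAt (bernoulliMean phat)
      ((∑ x, (∏ i, bernoulliWeight q (x i)) * ((∑ i, centredIndicator q (x i)) * (phat x - q)))
        / (q * (1 - q))) q := by
  refine (HasDerivAt.fun_sum (u := Finset.univ)
    (fun x _ => (hasDerivAt_likelihood x h0 h1).mul_const (phat x))).congr_deriv ?_
  symm
  have h := (bernoulli_moments q n).2.1
  calc _ = ((∑ x : Fin n → Fin 2, (∏ i, bernoulliWeight q (x i)) *
          ((∑ i, centredIndicator q (x i)) * (phat x - q)))
        + q * ∑ x : Fin n → Fin 2, (∏ i, bernoulliWeight q (x i)) *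
          ∑ i, centredIndicator q (x i)) / (q * (1 - q)) := by rw [h]; simp
    _ = _ := by
      rw [Finset.mul_sum, ← Finset.sum_add_distrib, Finset.sum_div]
      exact Finset.sum_congr rfl fun x _ => by ring

/-- Weighted Cauchy–Schwarz inequality. -/
lemma sq_sum_weight_mul_le {ι : Type*} [Fintype ι] (w f g : ι → ℝ) (hw : ∀ i, 0 ≤ w i) :
    (∑ i, w i * (f i * g i)) ^ 2 ≤ (∑ i, w i * f i ^ 2) * ∑ i, w i * g i ^ 2 :=
  Finset.sum_sq_le_sum_mul_sum_of_sq_le_mul _ (fun i _ => mul_nonneg (hw i) (sq_nonneg _))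
    (fun i _ => mul_nonneg (hw i) (sq_nonneg _)) (fun i _ => le_of_eq (by ring))

/-- The information inequality for the derivative of the mean. -/
lemma sq_deriv_bernoulliMean_le {n : ℕ} (phat : (Fin n → Fin 2) → ℝ) {q : ℝ} (h0 : 0 < q)
    (h1 : q < 1) :
    (deriv (bernoulliMean phat) q) ^ 2 ≤ n * bernoulliRisk phat q / (q * (1 - q)) := by
  have hpos : 0 < q * (1 - q) := mul_pos h0 (by linarith)
  rw [(hasDerivAt_bernoulliMean phat h0 h1).deriv, div_pow, div_le_div_iff₀ (by positivity) hpos]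
  have h := sq_sum_weight_mul_le (fun x : Fin n → Fin 2 => ∏ i, bernoulliWeight q (x i))
    (fun x => ∑ i, centredIndicator q (x i)) (fun x => phat x - q)
    (fun x => Finset.prod_nonneg fun _ _ => bernoulliWeight_nonneg h0.le h1.le _)
  rw [(bernoulli_moments q n).2.2] at h
  have hr : ∑ x : Fin n → Fin 2, (∏ i, bernoulliWeight q (x i)) * (phat x - q) ^ 2
      = bernoulliRisk phat q :=
    Finset.sum_congr rfl fun x _ => by ring
  rw [hr] at h
  calc _ ≤ _ := mul_le_mul_of_nonneg_right h hpos.le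
    _ = _ := by ring

lemma sq_bias_le {n : ℕ} (phat : (Fin n → Fin 2) → ℝ) {q : ℝ} (h0 : 0 ≤ q) (h1 : q ≤ 1) :
    (q - bernoulliMean phat q) ^ 2 ≤ bernoulliRisk phat q := by
  have h := sq_sum_weight_mul_le (fun x : Fin n → Fin 2 => ∏ i, bernoulliWeight q (x i))
    (fun _ => 1) (fun x => q - phat x)
    (fun x => Finset.prod_nonneg fun _ _ => bernoulliWeight_nonneg h0 h1 _)
  simp only [one_pow, mul_one, one_mul, mul_sub, Finset.sum_sub_distrib, ← Finset.sum_mul,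
    (bernoulli_moments q n).1] at h
  exact h

/-- A uniform risk bound on `[1/2, 1/2 + δ]` cannot be too small. -/
lemma le_sqrt_mul_of_bernoulliRisk_le {n : ℕ} (phat : (Fin n → Fin 2) → ℝ) {r δ : ℝ}
    (hδ : 0 < δ) (hδ' : δ < 1 / 2)
    (hr : ∀ q ∈ Set.Icc (1 / 2) (1 / 2 + δ), bernoulliRisk phat q ≤ r) :
    δ ≤ 2 * √r + δ * √(n * r / (1 / 4 - δ ^ 2)) := by
  have hbias : ∀ q ∈ Set.Icc (1 / 2) (1 / 2 + δ), |q - bernoulliMean phat q| ≤ √r := by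
    intro q hq
    exact Real.abs_le_sqrt ((sq_bias_le phat (by linarith [hq.1]) (by linarith [hq.2])).trans
      (hr q hq))
  have hd : ∀ q ∈ Set.Icc (1 / 2) (1 / 2 + δ), DifferentiableAt ℝ (bernoulliMean phat) q :=
    fun q hq => (hasDerivAt_bernoulliMean phat (by linarith [hq.1])
      (by linarith [hq.2])).differentiableAt
  have hden : 0 < 1 / 4 - δ ^ 2 := by nlinarith
  have hderiv : ∀ q ∈ Set.Icc (1 / 2) (1 / 2 + δ),
      deriv (bernoulliMean phat) q ≤ √(n * r / (1 / 4 - δ ^ 2)) := by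
    intro q hq
    have h0 : 0 < q := by linarith [hq.1]
    have h1 : q < 1 := by linarith [hq.2]
    refine Real.le_sqrt_of_sq_le ((sq_deriv_bernoulliMean_le phat h0 h1).trans ?_)
    have hrq := hr q hq
    have hR := bernoulliRisk_nonneg phat h0.le h1.le
    have hle : 1 / 4 - δ ^ 2 ≤ q * (1 - q) := by nlinarith [hq.1, hq.2]
    gcongr
    exact mul_nonneg n.cast_nonneg (hR.trans hrq)
  have hl : (1 / 2 : ℝ) ∈ Set.Icc (1 / 2 : ℝ) (1 / 2 + δ) := ⟨le_rfl, by linarith⟩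
  have hu : (1 / 2 + δ : ℝ) ∈ Set.Icc (1 / 2 : ℝ) (1 / 2 + δ) := ⟨by linarith, le_rfl⟩
  have hmv := (convex_Icc (1 / 2 : ℝ) (1 / 2 + δ)).image_sub_le_mul_sub_of_deriv_le
    (fun q hq => (hd q hq).continuousAt.continuousWithinAt)
    (fun q hq => (hd q (interior_subset hq)).differentiableWithinAt)
    (fun q hq => hderiv q (interior_subset hq)) _ hl _ hu (by linarith)
  have e1 := abs_le.1 (hbias _ hl)
  have e2 := abs_le.1 (hbias _ hu)
  linarith [e1.1, e2.2]

lemma le_mul_minimaxBernoulli {n : ℕ} (hn : 0 < n) {δ : ℝ} (hδ : 0 < δ) (hδ' : δ < 1 / 2) :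
    (δ / (2 / √n + δ / √(1 / 4 - δ ^ 2))) ^ 2 ≤ n * minimaxBernoulli n := by
  have hn' : (0 : ℝ) < n := by exact_mod_cast hn
  have hden : 0 < 1 / 4 - δ ^ 2 := by nlinarith
  suffices h : (δ / (2 / √n + δ / √(1 / 4 - δ ^ 2))) ^ 2 / n ≤ minimaxBernoulli n by
    rw [mul_comm]
    exact (div_le_iff₀ hn').1 h
  rw [minimaxBernoulli_eq]
  refine le_csInf ⟨_, fun _ => 0, fun _ => by simp, rfl⟩ ?_
  rintro r ⟨phat, hp, hreq⟩
  have hr : ∀ q ∈ Set.Icc (1 / 2 : ℝ) 1, bernoulliRisk phat q ≤ r := by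
    intro q hq
    rw [hreq]
    refine le_csSup ⟨1, ?_⟩ ⟨q, hq, rfl⟩
    rintro _ ⟨q, hq, rfl⟩
    exact bernoulliRisk_le_one hp (by linarith [hq.1]) hq.2
  have hr0 : 0 ≤ r :=
    (bernoulliRisk_nonneg phat zero_le_one le_rfl).trans (hr 1 ⟨by norm_num, le_rfl⟩)
  have h := le_sqrt_mul_of_bernoulliRisk_le phat hδ hδ'
    (fun q hq => hr q ⟨hq.1, by linarith [hq.2]⟩)
  rw [Real.sqrt_div (by positivity), Real.sqrt_mul hn'.le] at h
  have hsn : 0 < √(n : ℝ) := Real.sqrt_pos.2 hn'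
  have hsd : 0 < √(1 / 4 - δ ^ 2) := Real.sqrt_pos.2 hden
  have hle : δ / (2 / √n + δ / √(1 / 4 - δ ^ 2)) ≤ √n * √r := by
    rw [div_le_iff₀ (by positivity)]
    refine h.trans (le_of_eq ?_)
    field_simp
  rw [div_le_iff₀ hn']
  calc _ ≤ (√n * √r) ^ 2 := by gcongr
    _ = r * n := by rw [mul_pow, Real.sq_sqrt hn'.le, Real.sq_sqrt hr0, mul_comm]

/-- **Lemma 7:** the minimax squared-error risk for estimating `p(0)` from `n`
i.i.d. samples of a pmf `p` on `{0,1}` with `p(0) ≥ 1/2` satisfies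
`lim_{n→∞} n · inf_{p̂} sup_{p ∈ 𝒫} E[(p(0) - p̂(X^n))²] = 1/4`. -/
theorem minimax_bernoulli_limit :
    Filter.Tendsto (fun n : ℕ => (n : ℝ) * minimaxBernoulli n)
      Filter.atTop (nhds (1 / 4)) := by
  rw [tendsto_order]
  refine ⟨fun a ha => ?_, fun a ha =>
    Filter.Eventually.of_forall fun n => (mul_minimaxBernoulli_le n).trans_lt ha⟩
  obtain ⟨δ, hδ, hδ', hlt⟩ : ∃ δ : ℝ, 0 < δ ∧ δ < 1 / 2 ∧ a < 1 / 4 - δ ^ 2 := by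
    refine ⟨min (1 / 4) (1 / 4 - a), lt_min (by norm_num) (by linarith),
      (min_le_left _ _).trans_lt (by norm_num), ?_⟩
    have h1 := min_le_left (1 / 4) (1 / 4 - a)
    have h2 := min_le_right (1 / 4) (1 / 4 - a)
    have h3 : 0 < min (1 / 4) (1 / 4 - a) := lt_min (by norm_num) (by linarith)
    nlinarith
  have hden : 0 < 1 / 4 - δ ^ 2 := by nlinarith
  have hsd : 0 < √(1 / 4 - δ ^ 2) := Real.sqrt_pos.2 hden
  have hsqrt : Filter.Tendsto (fun n : ℕ => 2 / √(n : ℝ)) Filter.atTop (nhds 0) :=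
    (Real.tendsto_sqrt_atTop.comp tendsto_natCast_atTop_atTop).const_div_atTop 2
  have hlim : Filter.Tendsto (fun n : ℕ => (δ / (2 / √(n : ℝ) + δ / √(1 / 4 - δ ^ 2))) ^ 2)
      Filter.atTop (nhds (1 / 4 - δ ^ 2)) := by
    have hne : 0 + δ / √(1 / 4 - δ ^ 2) ≠ 0 := by positivity
    have h := ((tendsto_const_nhds (x := δ)).div
      (hsqrt.add_const (δ / √(1 / 4 - δ ^ 2))) hne).pow 2
    rwa [zero_add, div_div_cancel₀ hδ.ne', Real.sq_sqrt hden.le] at h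
  filter_upwards [hlim.eventually_const_lt hlt, Filter.eventually_gt_atTop 0] with n hn hpos
  exact hn.trans_le (le_mul_minimaxBernoulli hpos hδ hδ')
end
end
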